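/- Under the object identity constraint, the downward refinement operator ρ_f defined by the rewrite rules R0, R1, R2, and R3 is ideal (locally finite, complete, and proper) for the quasi-ordered set (G, ⊑), where ⊑ is regular subsumption under object identity. -/

import Mathlib

/-- A directed labeled graph (DLG) over a label type `L`, with vertices drawn from `ℕ`:
a finite vertex set `V`, a finite edge set `E ⊆ V × V`, and labeling functions for
vertices and edges. -/
structure DLG (L : Type) where
  V : Finset ℕ
  E : Finset (ℕ × ℕ)
  lv : ℕ → L
  le : ℕ × ℕ → L
  edge_mem : ∀ e ∈ E, e.1 ∈ V ∧ e.2 ∈ V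

namespace DLG

variable {L : Type}

/-- Undirected adjacency: there is an edge between `v` and `w` in either direction. -/
def adj (g : DLG L) (v w : ℕ) : Prop :=
  (v, w) ∈ g.E ∨ (w, v) ∈ g.E

/-- A DLG is connected when any two of its vertices are joined by an undirected path. -/
def Connected (g : DLG L) : Prop :=
  ∀ v ∈ g.V, ∀ w ∈ g.V, Relation.ReflTransGen g.adj v w

/-- A canonical fresh vertex not belonging to `g.V`. -/
def fresh (g : DLG L) : ℕ := g.V.sup id + 1

/-- The graph obtained by deleting the edge `e`. -/
def removeEdge (g : DLG L) (e : ℕ × ℕ) : DLG L where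
  V := g.V
  E := g.E.erase e
  lv := g.lv
  le := g.le
  edge_mem := fun e' he' => g.edge_mem e' (Finset.mem_of_mem_erase he')

/-- An edge `e ∈ E` is a bridge of `g` when removing it leaves a disconnected graph. -/
def IsBridge (g : DLG L) (e : ℕ × ℕ) : Prop :=
  e ∈ g.E ∧ ¬ (g.removeEdge e).Connected

/-- The set of edges of `g` incident to the vertex `v`. -/
def incident (g : DLG L) (v : ℕ) : Finset (ℕ × ℕ) :=
  g.E.filter fun e => e.1 = v ∨ e.2 = v

/-! ### Subsumption relations -/

/-- `m` witnesses that `g₁` subsumes `g₂` (regular subsumption). -/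
def SubsWith (g₁ g₂ : DLG L) (m : ℕ → ℕ) : Prop :=
  (∀ v ∈ g₁.V, m v ∈ g₂.V) ∧
  (∀ e ∈ g₁.E, (m e.1, m e.2) ∈ g₂.E) ∧
  (∀ v ∈ g₁.V, g₁.lv v = g₂.lv (m v)) ∧
  (∀ e ∈ g₁.E, g₁.le e = g₂.le (m e.1, m e.2))

/-- Regular subsumption `g₁ ⊑ g₂`. -/
def Subs (g₁ g₂ : DLG L) : Prop := ∃ m, SubsWith g₁ g₂ m

/-- The object-identity constraint on a vertex mapping: injectivity on `g₁.V`. -/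
def OI (g₁ : DLG L) (m : ℕ → ℕ) : Prop :=
  ∀ v₁ ∈ g₁.V, ∀ v₂ ∈ g₁.V, v₁ ≠ v₂ → m v₁ ≠ m v₂

/-- Regular subsumption under object identity. -/
def SubsOI (g₁ g₂ : DLG L) : Prop := ∃ m, SubsWith g₁ g₂ m ∧ OI g₁ m

/-- `m` and `me` witness that `g₁` trans-subsumes `g₂`: each edge of `g₁` is mapped to a
sequence of consecutive edges of `g₂` (given by the list of vertices `me e`), all carrying
the label of the original edge. -/
def TransSubsWith (g₁ g₂ : DLG L) (m : ℕ → ℕ) (me : ℕ × ℕ → List ℕ) : Prop :=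
  (∀ v ∈ g₁.V, m v ∈ g₂.V) ∧
  (∀ v ∈ g₁.V, g₁.lv v = g₂.lv (m v)) ∧
  (∀ e ∈ g₁.E,
    2 ≤ (me e).length ∧
    (me e).head? = some (m e.1) ∧
    (me e).getLast? = some (m e.2) ∧
    (me e).Chain' fun a b => (a, b) ∈ g₂.E ∧ g₂.le (a, b) = g₁.le e)

/-- Trans-subsumption `g₁ ⊑→ g₂`. -/
def TransSubs (g₁ g₂ : DLG L) : Prop := ∃ m me, TransSubsWith g₁ g₂ m me

/-- The object-identity constraint for trans-subsumption: `m` is injective on `g₁.V`, and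
no vertex of `g₁` other than the endpoints of an edge `e` of `g₁` is mapped into the
path `me e`. -/
def TransOI (g₁ : DLG L) (m : ℕ → ℕ) (me : ℕ × ℕ → List ℕ) : Prop :=
  OI g₁ m ∧ ∀ v ∈ g₁.V, ∀ e ∈ g₁.E, v ≠ e.1 → v ≠ e.2 → m v ∉ me e

/-- Trans-subsumption under object identity. -/
def TransSubsOI (g₁ g₂ : DLG L) : Prop :=
  ∃ m me, TransSubsWith g₁ g₂ m me ∧ TransOI g₁ m me

section OrderLabeled

variable [PartialOrder L]

/-- `m` witnesses subsumption relative to the partial order `≤` (i.e. `⪯`) on labels. -/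
def SubsPOWith (g₁ g₂ : DLG L) (m : ℕ → ℕ) : Prop :=
  (∀ v ∈ g₁.V, m v ∈ g₂.V) ∧
  (∀ e ∈ g₁.E, (m e.1, m e.2) ∈ g₂.E) ∧
  (∀ v ∈ g₁.V, g₁.lv v ≤ g₂.lv (m v)) ∧
  (∀ e ∈ g₁.E, g₁.le e ≤ g₂.le (m e.1, m e.2))

/-- Subsumption relative to `⪯`: `g₁ ⊑⪯ g₂`. -/
def SubsPO (g₁ g₂ : DLG L) : Prop := ∃ m, SubsPOWith g₁ g₂ m

/-- Subsumption relative to `⪯` under object identity. -/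
def SubsPOOI (g₁ g₂ : DLG L) : Prop := ∃ m, SubsPOWith g₁ g₂ m ∧ OI g₁ m

/-- `m` and `me` witness trans-subsumption relative to `⪯`. -/
def TransSubsPOWith (g₁ g₂ : DLG L) (m : ℕ → ℕ) (me : ℕ × ℕ → List ℕ) : Prop :=
  (∀ v ∈ g₁.V, m v ∈ g₂.V) ∧
  (∀ v ∈ g₁.V, g₁.lv v ≤ g₂.lv (m v)) ∧
  (∀ e ∈ g₁.E,
    2 ≤ (me e).length ∧
    (me e).head? = some (m e.1) ∧
    (me e).getLast? = some (m e.2) ∧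
    (me e).Chain' fun a b => (a, b) ∈ g₂.E ∧ g₁.le e ≤ g₂.le (a, b))

/-- Trans-subsumption relative to `⪯`: `g₁ ⊑→⪯ g₂`. -/
def TransSubsPO (g₁ g₂ : DLG L) : Prop := ∃ m me, TransSubsPOWith g₁ g₂ m me

/-- Trans-subsumption relative to `⪯` under object identity. -/
def TransSubsPOOI (g₁ g₂ : DLG L) : Prop :=
  ∃ m me, TransSubsPOWith g₁ g₂ m me ∧ TransOI g₁ m me

end OrderLabeled

/-! ### Refinement operators for flat-labeled DLGs -/

/-- The downward refinement operator `ρ_f`, given by rewrite rules R0, R1, R2, R3. -/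
def rho_f (g : DLG L) : Set (DLG L) :=
  {g' |
    -- R0: add a single vertex (labeled `a`) to the empty graph
    (g.V = ∅ ∧ g.E = ∅ ∧ ∃ a : L,
      g'.V = {g.fresh} ∧ g'.E = ∅ ∧
      g'.lv = Function.update g.lv g.fresh a ∧ g'.le = g.le) ∨
    -- R1: add a new vertex `v*` labeled `a` with outgoing edge `(v*, v₁)` labeled `b`
    (∃ v₁ ∈ g.V, ∃ a b : L,
      g'.V = insert g.fresh g.V ∧
      g'.E = insert (g.fresh, v₁) g.E ∧
      g'.lv = Function.update g.lv g.fresh a ∧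
      g'.le = Function.update g.le (g.fresh, v₁) b) ∨
    -- R2: add a new vertex `v*` labeled `a` with incoming edge `(v₁, v*)` labeled `b`
    (∃ v₁ ∈ g.V, ∃ a b : L,
      g'.V = insert g.fresh g.V ∧
      g'.E = insert (v₁, g.fresh) g.E ∧
      g'.lv = Function.update g.lv g.fresh a ∧
      g'.le = Function.update g.le (v₁, g.fresh) b) ∨
    -- R3: add an edge `(v₁, v₂)` labeled `a`
    (∃ v₁ ∈ g.V, ∃ v₂ ∈ g.V, (v₁, v₂) ∉ g.E ∧ ∃ a : L,
      g'.V = g.V ∧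
      g'.E = insert (v₁, v₂) g.E ∧
      g'.lv = g.lv ∧
      g'.le = Function.update g.le (v₁, v₂) a)}

/-- The downward refinement operator `ρ_tf`, given by rules R0–R3 together with the
split-edge rule R4. -/
def rho_tf (g : DLG L) : Set (DLG L) :=
  rho_f g ∪
  -- R4: split an edge `e` by a new vertex labeled `a`; both halves keep the label of `e`
  {g' | ∃ e ∈ g.E, ∃ a : L,
    g'.V = insert g.fresh g.V ∧
    g'.E = insert (e.1, g.fresh) (insert (g.fresh, e.2) (g.E.erase e)) ∧
    g'.lv = Function.update g.lv g.fresh a ∧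
    g'.le = Function.update (Function.update g.le (e.1, g.fresh) (g.le e))
      (g.fresh, e.2) (g.le e)}

/-- The upward refinement operator `γ_f`, given by rewrite rules UR0 and UR1. -/
def gamma_f (g : DLG L) : Set (DLG L) :=
  {g' |
    -- UR0: remove a non-bridge edge
    (∃ e ∈ g.E, ¬ g.IsBridge e ∧ g' = g.removeEdge e) ∨
    -- UR1: remove a vertex incident to at most one edge, with its incident edges
    (∃ v ∈ g.V, (g.incident v).card ≤ 1 ∧
      g'.V = g.V.erase v ∧ g'.E = g.E \ g.incident v ∧
      g'.lv = g.lv ∧ g'.le = g.le)}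

/-- The upward refinement operator `γ_tf`, given by rules UR0, UR1 together with the
shorten-edge rule UR2. -/
def gamma_tf (g : DLG L) : Set (DLG L) :=
  gamma_f g ∪
  -- UR2: replace edges `(v₁,v₂)`, `(v₂,v₃)` with the same label, where `v₂` has no other
  -- incident edges, by a single edge `(v₁,v₃)` with that label, deleting `v₂`
  {g' | ∃ v₁ v₂ v₃ : ℕ, (v₁, v₂) ∈ g.E ∧ (v₂, v₃) ∈ g.E ∧
    g.le (v₁, v₂) = g.le (v₂, v₃) ∧
    (∀ e ∈ g.E, e ≠ (v₁, v₂) → e.2 ≠ v₂) ∧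
    (∀ e ∈ g.E, e ≠ (v₂, v₃) → e.1 ≠ v₂) ∧
    g'.V = g.V.erase v₂ ∧
    g'.E = insert (v₁, v₃) ((g.E.erase (v₁, v₂)).erase (v₂, v₃)) ∧
    g'.lv = g.lv ∧
    g'.le = Function.update g.le (v₁, v₃) (g.le (v₁, v₂))}

/-! ### Refinement operators for order-labeled DLGs
Here the label set carries a partial order `≤` (standing for `⪯`) and `T` denotes the
distinguished most general label `⊤` (with `T ≤ a` for every label `a`). -/

section OrderLabeledOps

variable [PartialOrder L]

/-- The downward refinement operator `ρ_⪯`, given by rules R0PO–R5PO. -/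
def rhoPO (T : L) (g : DLG L) : Set (DLG L) :=
  {g' |
    -- R0PO: add a single vertex labeled ⊤ to the empty graph
    (g.V = ∅ ∧ g.E = ∅ ∧
      g'.V = {g.fresh} ∧ g'.E = ∅ ∧
      g'.lv = Function.update g.lv g.fresh T ∧ g'.le = g.le) ∨
    -- R1PO: add a new vertex `v*` labeled ⊤ and the edge `(v₁, v*)` labeled ⊤
    (∃ v₁ ∈ g.V,
      g'.V = insert g.fresh g.V ∧
      g'.E = insert (v₁, g.fresh) g.E ∧
      g'.lv = Function.update g.lv g.fresh T ∧
      g'.le = Function.update g.le (v₁, g.fresh) T) ∨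
    -- R2PO: add a new vertex `v*` labeled ⊤ and the edge `(v*, v₁)` labeled ⊤
    (∃ v₁ ∈ g.V,
      g'.V = insert g.fresh g.V ∧
      g'.E = insert (g.fresh, v₁) g.E ∧
      g'.lv = Function.update g.lv g.fresh T ∧
      g'.le = Function.update g.le (g.fresh, v₁) T) ∨
    -- R3PO: add an edge `(v₁, v₂)` labeled ⊤
    (∃ v₁ ∈ g.V, ∃ v₂ ∈ g.V, (v₁, v₂) ∉ g.E ∧
      g'.V = g.V ∧ g'.E = insert (v₁, v₂) g.E ∧
      g'.lv = g.lv ∧ g'.le = Function.update g.le (v₁, v₂) T) ∨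
    -- R4PO: refine a vertex label one step downwards in `⪯`
    (∃ v₁ ∈ g.V, ∃ b : L, g.lv v₁ < b ∧ (¬ ∃ c : L, g.lv v₁ < c ∧ c < b) ∧
      g'.V = g.V ∧ g'.E = g.E ∧
      g'.lv = Function.update g.lv v₁ b ∧ g'.le = g.le) ∨
    -- R5PO: refine an edge label one step downwards in `⪯`
    (∃ e ∈ g.E, ∃ b : L, g.le e < b ∧ (¬ ∃ c : L, g.le e < c ∧ c < b) ∧
      g'.V = g.V ∧ g'.E = g.E ∧
      g'.lv = g.lv ∧ g'.le = Function.update g.le e b)}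

/-- The downward refinement operator `ρ_t⪯`, given by rules R0PO–R5PO together with the
split-edge rule R6PO. -/
def rhoTPO (T : L) (g : DLG L) : Set (DLG L) :=
  rhoPO T g ∪
  -- R6PO: split an edge `e` by a new vertex labeled ⊤; both halves keep the label of `e`
  {g' | ∃ e ∈ g.E,
    g'.V = insert g.fresh g.V ∧
    g'.E = insert (e.1, g.fresh) (insert (g.fresh, e.2) (g.E.erase e)) ∧
    g'.lv = Function.update g.lv g.fresh T ∧
    g'.le = Function.update (Function.update g.le (e.1, g.fresh) (g.le e))
      (g.fresh, e.2) (g.le e)}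

/-- The upward refinement operator `γ_⪯`, given by rules UR0PO–UR3PO. -/
def gammaPO (T : L) (g : DLG L) : Set (DLG L) :=
  {g' |
    -- UR0PO: generalize a vertex label one step upwards in `⪯`
    (∃ v₁ ∈ g.V, ∃ b : L, b < g.lv v₁ ∧ (¬ ∃ c : L, b < c ∧ c < g.lv v₁) ∧
      g'.V = g.V ∧ g'.E = g.E ∧
      g'.lv = Function.update g.lv v₁ b ∧ g'.le = g.le) ∨
    -- UR1PO: generalize an edge label one step upwards in `⪯`
    (∃ e ∈ g.E, ∃ b : L, b < g.le e ∧ (¬ ∃ c : L, b < c ∧ c < g.le e) ∧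
      g'.V = g.V ∧ g'.E = g.E ∧
      g'.lv = g.lv ∧ g'.le = Function.update g.le e b) ∨
    -- UR2PO: remove a non-bridge edge labeled ⊤
    (∃ e ∈ g.E, g.le e = T ∧ ¬ g.IsBridge e ∧ g' = g.removeEdge e) ∨
    -- UR3PO: remove a vertex labeled ⊤ incident to at most one edge, all incident
    -- edges being labeled ⊤, together with those edges
    (∃ v ∈ g.V, g.lv v = T ∧ (g.incident v).card ≤ 1 ∧
      (∀ e ∈ g.incident v, g.le e = T) ∧
      g'.V = g.V.erase v ∧ g'.E = g.E \ g.incident v ∧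
      g'.lv = g.lv ∧ g'.le = g.le)}

/-- The upward refinement operator `γ_t⪯`, given by rules UR0PO–UR3PO together with the
shorten-edge rule UR4PO. -/
def gammaTPO (T : L) (g : DLG L) : Set (DLG L) :=
  gammaPO T g ∪
  -- UR4PO: as UR2, additionally requiring the removed middle vertex to be labeled ⊤
  {g' | ∃ v₁ v₂ v₃ : ℕ, (v₁, v₂) ∈ g.E ∧ (v₂, v₃) ∈ g.E ∧
    g.lv v₂ = T ∧
    g.le (v₁, v₂) = g.le (v₂, v₃) ∧
    (∀ e ∈ g.E, e ≠ (v₁, v₂) → e.2 ≠ v₂) ∧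
    (∀ e ∈ g.E, e ≠ (v₂, v₃) → e.1 ≠ v₂) ∧
    g'.V = g.V.erase v₂ ∧
    g'.E = insert (v₁, v₃) ((g.E.erase (v₁, v₂)).erase (v₂, v₃)) ∧
    g'.lv = g.lv ∧
    g'.le = Function.update g.le (v₁, v₃) (g.le (v₁, v₂))}

end OrderLabeledOps

/-- The cover of `g₁` over `g₂` via a mapping `m`: the subgraph of `g₂` consisting of the
vertices and edges referred to by `m`. -/
def cover (g₁ g₂ : DLG L) (m : ℕ → ℕ) : DLG L where
  V := g₁.V.image m
  E := g₁.E.image fun e => (m e.1, m e.2)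
  lv := g₂.lv
  le := g₂.le
  edge_mem := by
    intro e he
    simp only [Finset.mem_image] at he
    obtain ⟨e', he', rfl⟩ := he
    exact ⟨Finset.mem_image_of_mem m (g₁.edge_mem e' he').1,
      Finset.mem_image_of_mem m (g₁.edge_mem e' he').2⟩

end DLG

namespace DLG

variable {L : Type}

/-- The number of vertices plus the number of edges of a graph. -/
def size (g : DLG L) : ℕ := g.V.card + g.E.card

lemma lt_fresh {g : DLG L} {v : ℕ} (hv : v ∈ g.V) : v < g.fresh :=
  Nat.lt_succ_of_le (Finset.le_sup (f := id) hv)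

lemma fresh_notMem (g : DLG L) : g.fresh ∉ g.V := fun h => lt_irrefl _ (lt_fresh h)

lemma fresh_fst_notMem (g : DLG L) (v : ℕ) : (g.fresh, v) ∉ g.E :=
  fun h => g.fresh_notMem (g.edge_mem _ h).1

lemma fresh_snd_notMem (g : DLG L) (v : ℕ) : (v, g.fresh) ∉ g.E :=
  fun h => g.fresh_notMem (g.edge_mem _ h).2

lemma edges_eq_empty {g : DLG L} (h : g.V = ∅) : g.E = ∅ := by
  refine Finset.eq_empty_of_forall_notMem fun e he => ?_
  simpa [h] using (g.edge_mem e he).1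

lemma size_lt_of_mem_rho_f {g g' : DLG L} (h : g' ∈ rho_f g) : g.size < g'.size := by
  unfold size
  rcases h with ⟨hV, hE, a, hV', hE', -⟩ | ⟨v, -, a, b, hV', hE', -⟩ |
    ⟨v, -, a, b, hV', hE', -⟩ | ⟨v, -, w, -, he, a, hV', hE', -⟩
  · simp [hV, hE, hV', hE']
  · rw [hV', hE', Finset.card_insert_of_notMem g.fresh_notMem,
      Finset.card_insert_of_notMem (g.fresh_fst_notMem v)]
    omega
  · rw [hV', hE', Finset.card_insert_of_notMem g.fresh_notMem,
      Finset.card_insert_of_notMem (g.fresh_snd_notMem v)]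
    omega
  · rw [hV', hE', Finset.card_insert_of_notMem he]
    omega

lemma OI.injOn {g : DLG L} {m : ℕ → ℕ} (h : g.OI m) : Set.InjOn m g.V :=
  fun v hv w hw hvw => by_contra fun hne => h v hv w hw hne hvw

lemma OI.injOn_edges {g : DLG L} {m : ℕ → ℕ} (h : g.OI m) :
    Set.InjOn (Prod.map m m) g.E := by
  intro e he f hf hef
  obtain ⟨h₁, h₂⟩ := Prod.ext_iff.1 hef
  exact Prod.ext (h.injOn (g.edge_mem e he).1 (g.edge_mem f hf).1 h₁)
    (h.injOn (g.edge_mem e he).2 (g.edge_mem f hf).2 h₂)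

lemma SubsOI.size_le {g₁ g₂ : DLG L} (h : SubsOI g₁ g₂) : g₁.size ≤ g₂.size := by
  obtain ⟨m, ⟨hV, hE, -, -⟩, hm⟩ := h
  exact add_le_add (Finset.card_le_card_of_injOn m hV hm.injOn)
    (Finset.card_le_card_of_injOn (Prod.map m m) hE hm.injOn_edges)

/-- A graph is determined by its vertices, edges and labelings. -/
lemma injective_data :
    Function.Injective fun g : DLG L => (g.V, g.E, g.lv, g.le) := by
  rintro ⟨V, E, lv, le, h⟩ ⟨V', E', lv', le', h'⟩ heq
  simp only [Prod.mk.injEq] at heq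
  obtain ⟨rfl, rfl, rfl, rfl⟩ := heq
  rfl

lemma finite_rho_f [Finite L] (g : DLG L) : (rho_f g).Finite := by
  classical
  let V' : Finset ℕ := insert g.fresh g.V
  let P : Set (ℕ × ℕ) := ↑(V' ×ˢ V')
  have hP : P.Finite := Finset.finite_toSet _
  have hfin : (({{g.fresh}, V', g.V} : Set (Finset ℕ)) ×ˢ
      (insert g.E ((fun e => insert e g.E) '' P)) ×ˢ
      (insert g.lv (Set.range (Function.update g.lv g.fresh))) ×ˢ
      (insert g.le (Set.image2 (Function.update g.le) P Set.univ))).Finite :=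
    (Set.toFinite _).prod (((hP.image _).insert _).prod (((Set.finite_range _).insert _).prod
      ((hP.image2 _ Set.finite_univ).insert _)))
  refine (hfin.preimage injective_data.injOn).subset ?_
  have hf : g.fresh ∈ V' := Finset.mem_insert_self _ _
  have hV : ∀ {v}, v ∈ g.V → v ∈ V' := fun hv => Finset.mem_insert_of_mem hv
  have hpair : ∀ {v w}, v ∈ V' → w ∈ V' → (v, w) ∈ P := fun hv hw =>
    Finset.mem_coe.2 (Finset.mem_product.2 ⟨hv, hw⟩)
  rintro g' (⟨-, hE, a, hV', hE', hl, hl'⟩ | ⟨v, hv, a, b, hV', hE', hl, hl'⟩ |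
    ⟨v, hv, a, b, hV', hE', hl, hl'⟩ | ⟨v, hv, w, hw, -, a, hV', hE', hl, hl'⟩)
  · exact ⟨.inl hV', .inl (hE'.trans hE.symm), .inr ⟨a, hl.symm⟩, .inl hl'⟩
  · exact ⟨.inr (.inl hV'), .inr ⟨_, hpair hf (hV hv), hE'.symm⟩, .inr ⟨a, hl.symm⟩,
      .inr ⟨_, hpair hf (hV hv), b, trivial, hl'.symm⟩⟩
  · exact ⟨.inr (.inl hV'), .inr ⟨_, hpair (hV hv) hf, hE'.symm⟩, .inr ⟨a, hl.symm⟩,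
      .inr ⟨_, hpair (hV hv) hf, b, trivial, hl'.symm⟩⟩
  · exact ⟨.inr (.inr hV'), .inr ⟨_, hpair (hV hv) (hV hw), hE'.symm⟩, .inl hl,
      .inr ⟨_, hpair (hV hv) (hV hw), a, trivial, hl'.symm⟩⟩

/-- In a connected graph, some edge leaves every nonempty proper set of vertices. -/
lemma Connected.exists_adj_of_mem_of_notMem {g : DLG L} (hg : g.Connected) {S : Set ℕ}
    {v w : ℕ} (hv : v ∈ g.V) (hw : w ∈ g.V) (hvS : v ∈ S) (hwS : w ∉ S) :
    ∃ x ∈ S, ∃ y ∉ S, g.adj x y := by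
  by_contra! hcon
  have key : ∀ u, Relation.ReflTransGen g.adj v u → u ∈ S := by
    intro u hu
    induction hu with
    | refl => exact hvS
    | tail _ hadj ih => exact by_contra fun hc => hcon _ ih _ hc hadj
  exact hwS (key w (hg v hv w hw))

/-- A witness that hits all vertices and edges can be inverted. -/
lemma SubsWith.subsOI_of_surj {g₁ g₂ : DLG L} {m : ℕ → ℕ} (h : SubsWith g₁ g₂ m)
    (hm : g₁.OI m) (hV : ∀ w ∈ g₂.V, ∃ v ∈ g₁.V, m v = w)
    (hE : ∀ e ∈ g₂.E, ∃ f ∈ g₁.E, (m f.1, m f.2) = e) : SubsOI g₂ g₁ := by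
  obtain ⟨-, -, hl, hl'⟩ := h
  choose! n hn hmn using hV
  have hnm : ∀ v ∈ g₁.V, m v ∈ g₂.V → n (m v) = v := fun v hv hv' =>
    hm.injOn (hn _ hv') hv (hmn _ hv')
  have hedge : ∀ e ∈ g₂.E, ∃ f ∈ g₁.E, (m f.1, m f.2) = e ∧ (n e.1, n e.2) = f := by
    intro e he
    obtain ⟨f, hf, rfl⟩ := hE e he
    refine ⟨f, hf, rfl, Prod.ext ?_ ?_⟩
    · exact hnm _ (g₁.edge_mem f hf).1 (g₂.edge_mem _ he).1
    · exact hnm _ (g₁.edge_mem f hf).2 (g₂.edge_mem _ he).2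
  refine ⟨n, ⟨hn, fun e he => ?_, fun v hv => ?_, fun e he => ?_⟩, fun v hv w hw hne heq => ?_⟩
  · obtain ⟨f, hf, -, hnf⟩ := hedge e he
    exact hnf ▸ hf
  · rw [hl _ (hn v hv), hmn v hv]
  · obtain ⟨f, hf, hmf, hnf⟩ := hedge e he
    rw [hnf, hl' f hf, hmf]
  · exact hne (by rw [← hmn v hv, ← hmn w hw, heq])

/-- The graph obtained by adding an edge between existing vertices. -/
def addEdge (g : DLG L) (e : ℕ × ℕ) (h₁ : e.1 ∈ g.V) (h₂ : e.2 ∈ g.V) (b : L) : DLG L where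
  V := g.V
  E := insert e g.E
  lv := g.lv
  le := Function.update g.le e b
  edge_mem := by
    intro f hf
    rcases Finset.mem_insert.1 hf with rfl | hf
    exacts [⟨h₁, h₂⟩, g.edge_mem f hf]

/-- The graph obtained by adding a fresh isolated vertex. -/
def addVertex (g : DLG L) (a : L) : DLG L where
  V := insert g.fresh g.V
  E := g.E
  lv := Function.update g.lv g.fresh a
  le := g.le
  edge_mem := fun e he =>
    ⟨Finset.mem_insert_of_mem (g.edge_mem e he).1, Finset.mem_insert_of_mem (g.edge_mem e he).2⟩

lemma SubsWith.addEdge {g₁ g₂ : DLG L} {m : ℕ → ℕ} (h : SubsWith g₁ g₂ m) {e : ℕ × ℕ}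
    (h₁ : e.1 ∈ g₁.V) (h₂ : e.2 ∈ g₁.V) (he : (m e.1, m e.2) ∈ g₂.E) :
    SubsWith (g₁.addEdge e h₁ h₂ (g₂.le (m e.1, m e.2))) g₂ m := by
  obtain ⟨hV, hE, hl, hl'⟩ := h
  refine ⟨hV, fun f hf => ?_, hl, fun f hf => ?_⟩
  · rcases Finset.mem_insert.1 hf with rfl | hf
    exacts [he, hE f hf]
  · by_cases hfe : f = e
    · subst hfe
      simp [DLG.addEdge]
    · simpa [DLG.addEdge, hfe] using hl' f (Finset.mem_of_mem_insert_of_ne hf hfe)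

lemma update_fresh (g : DLG L) {α : Type*} (m : ℕ → α) (w : α) {v : ℕ} (hv : v ∈ g.V) :
    Function.update m g.fresh w v = m v :=
  Function.update_of_ne (lt_fresh hv).ne _ _

lemma SubsWith.addVertex {g₁ g₂ : DLG L} {m : ℕ → ℕ} (h : SubsWith g₁ g₂ m) {w : ℕ}
    (hw : w ∈ g₂.V) :
    SubsWith (g₁.addVertex (g₂.lv w)) g₂ (Function.update m g₁.fresh w) := by
  obtain ⟨hV, hE, hl, hl'⟩ := h
  refine ⟨fun v hv => ?_, fun e he => ?_, fun v hv => ?_, fun e he => ?_⟩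
  · rcases Finset.mem_insert.1 hv with rfl | hv
    · simpa using hw
    · rw [g₁.update_fresh m w hv]
      exact hV v hv
  · rw [g₁.update_fresh m w (g₁.edge_mem e he).1, g₁.update_fresh m w (g₁.edge_mem e he).2]
    exact hE e he
  · rcases Finset.mem_insert.1 hv with rfl | hv
    · simp [DLG.addVertex]
    · rw [g₁.update_fresh m w hv]
      exact (g₁.update_fresh g₁.lv _ hv).trans (hl v hv)
  · rw [g₁.update_fresh m w (g₁.edge_mem e he).1, g₁.update_fresh m w (g₁.edge_mem e he).2]
    exact hl' e he

lemma OI.addVertex {g : DLG L} {m : ℕ → ℕ} (h : g.OI m) {w : ℕ} (hw : ∀ v ∈ g.V, m v ≠ w)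
    (a : L) : (g.addVertex a).OI (Function.update m g.fresh w) := by
  intro u hu v hv hne
  rcases Finset.mem_insert.1 hu with rfl | hu <;> rcases Finset.mem_insert.1 hv with rfl | hv
  · exact absurd rfl hne
  · rw [Function.update_self, g.update_fresh m w hv]
    exact (hw v hv).symm
  · rw [Function.update_self, g.update_fresh m w hu]
    exact hw u hu
  · rw [g.update_fresh m w hu, g.update_fresh m w hv]
    exact h u hu v hv hne

/-- A graph that strictly subsumes a connected graph has a refinement still subsuming it. -/
lemma exists_mem_rho_f_subsOI {g₁ g₂ : DLG L} (hg₂ : g₂.Connected) (h₁₂ : SubsOI g₁ g₂)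
    (h₂₁ : ¬ SubsOI g₂ g₁) : ∃ g ∈ rho_f g₁, SubsOI g g₂ := by
  obtain ⟨m, hm, hOI⟩ := h₁₂
  by_cases hV : ∀ w ∈ g₂.V, ∃ v ∈ g₁.V, m v = w
  · have hE : ¬ ∀ e ∈ g₂.E, ∃ f ∈ g₁.E, (m f.1, m f.2) = e :=
      fun hE => h₂₁ (hm.subsOI_of_surj hOI hV hE)
    push Not at hE
    obtain ⟨⟨x, y⟩, he, hne⟩ := hE
    obtain ⟨v, hv, rfl⟩ := hV x (g₂.edge_mem _ he).1
    obtain ⟨w, hw, rfl⟩ := hV y (g₂.edge_mem _ he).2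
    exact ⟨g₁.addEdge (v, w) hv hw _, .inr (.inr (.inr ⟨v, hv, w, hw,
      fun hvw => hne _ hvw rfl, _, rfl, rfl, rfl, rfl⟩)), m, hm.addEdge hv hw he, hOI⟩
  push Not at hV
  obtain ⟨w, hw, hmw⟩ := hV
  rcases g₁.V.eq_empty_or_nonempty with hV₁ | ⟨v₀, hv₀⟩
  · have hE₁ := edges_eq_empty hV₁
    exact ⟨g₁.addVertex (g₂.lv w), .inl ⟨hV₁, hE₁, _, by simp [addVertex, hV₁], hE₁, rfl, rfl⟩,
      _, hm.addVertex hw, hOI.addVertex hmw (g₂.lv w)⟩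
  obtain ⟨_, ⟨v, hv, rfl⟩, y, hy, hadj⟩ := hg₂.exists_adj_of_mem_of_notMem (S := m '' g₁.V)
    (hm.1 v₀ hv₀) hw ⟨v₀, hv₀, rfl⟩ (by rintro ⟨v, hv, hvw⟩; exact hmw v hv hvw)
  have hy' : ∀ v ∈ g₁.V, m v ≠ y := fun v hv h => hy ⟨v, hv, h⟩
  have hyV : y ∈ g₂.V := hadj.elim (fun h => (g₂.edge_mem _ h).2) fun h => (g₂.edge_mem _ h).1
  have hfresh : g₁.fresh ∈ (g₁.addVertex (g₂.lv y)).V := Finset.mem_insert_self _ _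
  have hv' : v ∈ (g₁.addVertex (g₂.lv y)).V := Finset.mem_insert_of_mem hv
  have hmv : Function.update m g₁.fresh y v = m v := g₁.update_fresh m y hv
  have hmf : Function.update m g₁.fresh y g₁.fresh = y := Function.update_self ..
  rcases hadj with hadj | hadj
  · exact ⟨(g₁.addVertex (g₂.lv y)).addEdge (v, g₁.fresh) hv' hfresh _,
      .inr (.inr (.inl ⟨v, hv, _, _, rfl, rfl, rfl, rfl⟩)), _,
      (hm.addVertex hyV).addEdge hv' hfresh (by simpa only [hmv, hmf] using hadj),
      hOI.addVertex hy' (g₂.lv y)⟩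
  · exact ⟨(g₁.addVertex (g₂.lv y)).addEdge (g₁.fresh, v) hfresh hv' _,
      .inr (.inl ⟨v, hv, _, _, rfl, rfl, rfl, rfl⟩), _,
      (hm.addVertex hyV).addEdge hfresh hv' (by simpa only [hmv, hmf] using hadj),
      hOI.addVertex hy' (g₂.lv y)⟩

lemma exists_reflTransGen_rho_f {g₁ g₂ : DLG L} (hg₂ : g₂.Connected) (h₁₂ : SubsOI g₁ g₂) :
    ∃ h : DLG L, Relation.ReflTransGen (fun x y => y ∈ rho_f x) g₁ h ∧
      SubsOI h g₂ ∧ SubsOI g₂ h := by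
  by_cases h₂₁ : SubsOI g₂ g₁
  · exact ⟨g₁, .refl, h₁₂, h₂₁⟩
  obtain ⟨g, hg, hsub⟩ := exists_mem_rho_f_subsOI hg₂ h₁₂ h₂₁
  have hlt := size_lt_of_mem_rho_f hg
  have hle := hsub.size_le
  obtain ⟨h, hchain, heqv⟩ := exists_reflTransGen_rho_f hg₂ hsub
  exact ⟨h, .head hg hchain, heqv⟩
termination_by g₂.size - g₁.size

end DLG

theorem rho_f_ideal_under_OI {L : Type} [Fintype L] :
    -- locally finite
    (∀ g : DLG L, g.Connected → (DLG.rho_f g).Finite) ∧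
    -- complete: if g₁ strictly subsumes g₂, a finite chain of refinements starting
    -- at g₁ reaches a graph equivalent to g₂
    (∀ g₁ g₂ : DLG L, g₁.Connected → g₂.Connected →
      DLG.SubsOI g₁ g₂ → ¬ DLG.SubsOI g₂ g₁ →
      ∃ h : DLG L, Relation.ReflTransGen (fun x y => y ∈ DLG.rho_f x) g₁ h ∧
        DLG.SubsOI h g₂ ∧ DLG.SubsOI g₂ h) ∧
    -- proper: no refinement of g is equivalent to g
    (∀ g : DLG L, g.Connected → ∀ g' ∈ DLG.rho_f g,
      ¬ (DLG.SubsOI g g' ∧ DLG.SubsOI g' g)) := by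
  refine ⟨fun g _ => g.finite_rho_f, fun g₁ g₂ _ hg₂ h _ => DLG.exists_reflTransGen_rho_f hg₂ h,
    fun g _ g' hg' h => ?_⟩
  exact (DLG.size_lt_of_mem_rho_f hg').not_ge h.2.size_le
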